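/- Fix k ≥ 0 and n ≥ 0. The number of sequences (v_1, ..., v_n) of positive integers satisfying 1 ≤ v_i ≤ i + k for all i, and satisfying for all 1 ≤ i < j ≤ n that v_j − (j − i) is not in the interval [1, v_i − 1], equals the generalized Catalan number C_n^(k) = ((k+1)/(2n+k+1)) * binomial(2n+k+1, n). -/

import Mathlib

def gc (n k : ℕ) : ℚ := ((k : ℚ) + 1) / (2 * (n : ℚ) + (k : ℚ) + 1) * ((2 * n + k + 1).choose n : ℚ)

def cat (n : ℕ) : ℚ := 1 / ((n : ℚ) + 1) * ((2 * n).choose n : ℚ)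

def Cond {n : ℕ} (u : Fin n → ℕ) : Prop :=
  ∀ i j : Fin n, i < j →
    ¬(1 ≤ (u j : ℤ) - (((j : ℕ) : ℤ) - ((i : ℕ) : ℤ)) ∧
      (u j : ℤ) - (((j : ℕ) : ℤ) - ((i : ℕ) : ℤ)) ≤ (u i : ℤ) - 1)

def ff : ℕ → ℕ → ℕ
  | 0, _ => 1
  | n + 1, m => ∑ r ∈ Finset.range m, ff n (r + 2)

lemma gc_base (n : ℕ) : gc (n + 1) 0 = gc n 1 := by
  have h := Nat.add_one_mul_choose_eq (2 * n + 2) n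
  have h' : (((2 * n + 2 : ℕ) : ℚ) + 1) * ((2 * n + 2).choose n : ℚ)
      = ((2 * n + 2 + 1).choose (n + 1) : ℚ) * ((n : ℚ) + 1) := by exact_mod_cast h
  unfold gc
  have e1 : 2 * (n + 1) + 0 + 1 = 2 * n + 2 + 1 := by ring
  have e2 : 2 * n + 1 + 1 = 2 * n + 2 := by ring
  rw [e1, e2]
  generalize ((2 * n + 2 + 1).choose (n + 1) : ℚ) = X at *
  generalize ((2 * n + 2).choose n : ℚ) = Y at *
  have hn : (0 : ℚ) ≤ n := Nat.cast_nonneg n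
  push_cast at *
  have a : (n : ℚ) + 1 ≠ 0 := by positivity
  have hX : X = (2 * n + 2 + 1) * Y / (n + 1) := by rw [eq_div_iff a, h']
  rw [hX]
  have b : (2 * n + 2 + 1 : ℚ) ≠ 0 := by positivity
  have b' : (2 * (n + 1) + 0 + 1 : ℚ) ≠ 0 := by positivity
  have c : (2 * n + 1 + 1 : ℚ) ≠ 0 := by positivity
  field_simp
  ring

lemma gc_step (n k : ℕ) : gc (n + 1) (k + 1) = gc (n + 1) k + gc n (k + 2) := by
  have h := Nat.add_one_mul_choose_eq (2 * n + k + 3) n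
  have h' : (((2 * n + k + 3 : ℕ) : ℚ) + 1) * ((2 * n + k + 3).choose n : ℚ)
      = ((2 * n + k + 3 + 1).choose (n + 1) : ℚ) * ((n : ℚ) + 1) := by exact_mod_cast h
  have g : ((2 * n + k + 3 + 1).choose (n + 1) : ℚ) =
      ((2 * n + k + 3).choose n : ℚ) + ((2 * n + k + 3).choose (n + 1) : ℚ) := by
    exact_mod_cast Nat.choose_succ_succ (2 * n + k + 3) n
  unfold gc
  have e1 : 2 * (n + 1) + (k + 1) + 1 = 2 * n + k + 3 + 1 := by ring
  have e2 : 2 * (n + 1) + k + 1 = 2 * n + k + 3 := by ring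
  have e3 : 2 * n + (k + 2) + 1 = 2 * n + k + 3 := by ring
  rw [e1, e2, e3]
  generalize ((2 * n + k + 3 + 1).choose (n + 1) : ℚ) = X at *
  generalize ((2 * n + k + 3).choose n : ℚ) = Y at *
  generalize ((2 * n + k + 3).choose (n + 1) : ℚ) = Z at *
  have hn : (0 : ℚ) ≤ n := Nat.cast_nonneg n
  have hk : (0 : ℚ) ≤ k := Nat.cast_nonneg k
  push_cast at *
  have a : (n : ℚ) + 1 ≠ 0 := by positivity
  have hX : X = (2 * n + k + 3 + 1) * Y / (n + 1) := by rw [eq_div_iff a, h']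
  have hZ : Z = X - Y := by linarith
  rw [hZ, hX]
  have q1 : (2 * (n + 1) + (k + 1) + 1 : ℚ) = 2 * n + k + 4 := by ring
  have q2 : (2 * (n + 1) + k + 1 : ℚ) = 2 * n + k + 3 := by ring
  have q3 : (2 * n + (k + 2) + 1 : ℚ) = 2 * n + k + 3 := by ring
  have q4 : (2 * n + k + 3 + 1 : ℚ) = 2 * n + k + 4 := by ring
  rw [q1, q2, q3, q4]
  have b : (2 * n + k + 4 : ℚ) ≠ 0 := by positivity
  have c : (2 * n + k + 3 : ℚ) ≠ 0 := by positivity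
  field_simp
  ring

lemma ff_gc (n : ℕ) : ∀ k, (ff n (k + 1) : ℚ) = gc n k := by
  induction n with
  | zero =>
    intro k
    have : (k : ℚ) + 1 ≠ 0 := by positivity
    simp [ff, gc, this]
  | succ n ih =>
    intro k
    induction k with
    | zero => simp [ff, gc_base, ← ih 1]
    | succ k ihk =>
      rw [gc_step, ← ihk, ← ih (k + 2)]
      simp only [ff]
      rw [Finset.sum_range_succ]
      push_cast
      rfl

lemma sum_rank (g : ℕ → ℕ) (S : Finset ℤ) :
    ∑ x ∈ S, g (S.filter (· ≤ x)).card = ∑ r ∈ Finset.range S.card, g (r + 1) := by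
  induction S using Finset.induction_on_max with
  | empty => simp
  | insert a s h ih =>
    have ha : a ∉ s := fun hh => lt_irrefl _ (h a hh)
    rw [Finset.sum_insert ha, Finset.card_insert_of_notMem ha, Finset.sum_range_succ, ← ih, add_comm]
    congr 1
    · apply Finset.sum_congr rfl
      intro x hx
      rw [Finset.filter_insert, if_neg (not_le.2 (h x hx))]
    · rw [Finset.filter_true_of_mem, Finset.card_insert_of_notMem ha]
      intro x hx
      rcases Finset.mem_insert.1 hx with rfl | hx
      · exact le_rfl
      · exact (h x hx).le

def PP (n : ℕ) (S : Finset ℤ) (t : ℤ) (a : Fin n → ℤ) : Prop :=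
  (∀ j : Fin n, a j ∈ S ∨ (t ≤ a j ∧ a j < t + (j : ℕ))) ∧
  ∀ i j : Fin n, i < j → a j ≤ a i ∨ t + (i : ℕ) ≤ a j

lemma PP_cons (n : ℕ) (S : Finset ℤ) (t : ℤ) (hS : ∀ s ∈ S, s < t) (x : ℤ) (b : Fin n → ℤ) :
    PP (n + 1) S t (Fin.cons x b) ↔
      x ∈ S ∧ PP n (insert t (S.filter (· ≤ x))) (t + 1) b := by
  unfold PP
  simp only [Fin.forall_fin_succ, Fin.cons_zero, Fin.cons_succ, Fin.succ_lt_succ_iff,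
    Fin.val_succ, Fin.val_zero, Finset.mem_insert, Finset.mem_filter, Fin.succ_pos,
    Fin.not_lt_zero, false_imp_iff, true_and, forall_const]
  push_cast
  constructor
  · rintro ⟨⟨h0, h1⟩, h2, h3⟩
    have hx : x ∈ S := by
      rcases h0 with h | h
      · exact h
      · omega
    refine ⟨hx, fun j => ?_, fun i j hij => ?_⟩
    · rcases h1 j with h | h
      · have := hS _ h
        rcases h2 j with h' | h'
        · exact Or.inl (Or.inr ⟨h, h'⟩)
        · omega
      · by_cases e : b j = t
        · exact Or.inl (Or.inl e)
        · right; omega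
    · have := h3 i j hij
      omega
  · rintro ⟨hx, h1, h2⟩
    have := hS _ hx
    refine ⟨⟨Or.inl hx, fun j => ?_⟩, fun j => ?_, fun i j hij => ?_⟩
    · rcases h1 j with (h | h) | h
      · right; omega
      · exact Or.inl h.1
      · right; omega
    · rcases h1 j with (h | h) | h
      · right; omega
      · exact Or.inl h.2
      · right; omega
    · have := h2 i j hij
      omega

lemma PP_count (n : ℕ) : ∀ (S : Finset ℤ) (t : ℤ), (∀ s ∈ S, s < t) →
    ∃ F : Finset (Fin n → ℤ), (∀ a, a ∈ F ↔ PP n S t a) ∧ F.card = ff n S.card := by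
  induction n with
  | zero =>
    intro S t _
    exact ⟨Finset.univ, fun a => ⟨fun _ => ⟨fun j => j.elim0, fun j => j.elim0⟩, fun _ => Finset.mem_univ a⟩, by simp [ff]⟩
  | succ n ih =>
    intro S t hS
    have H : ∀ x : ℤ, ∃ F : Finset (Fin n → ℤ),
        (∀ a, a ∈ F ↔ PP n (insert t (S.filter (· ≤ x))) (t + 1) a) ∧
        F.card = ff n ((S.filter (· ≤ x)).card + 1) := by
      intro x
      have hn : t ∉ S.filter (· ≤ x) := fun h =>
        lt_irrefl _ (hS t (Finset.mem_filter.1 h).1)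
      rw [← Finset.card_insert_of_notMem hn]
      apply ih
      intro s hs
      rcases Finset.mem_insert.1 hs with rfl | hs
      · omega
      · have := hS s (Finset.mem_filter.1 hs).1
        omega
    choose G hG hc using H
    classical
    refine ⟨S.biUnion fun x => (G x).image fun b => (Fin.cons x b : Fin (n + 1) → ℤ), ?_, ?_⟩
    · intro a
      have e : a = Fin.cons (a 0) (Fin.tail a) := (Fin.cons_self_tail a).symm
      rw [e, PP_cons n S t hS, ← hG]
      simp only [Finset.mem_biUnion, Finset.mem_image]
      constructor
      · rintro ⟨x, hx, b, hb, h⟩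
        obtain ⟨h1, h2⟩ := Fin.cons_inj.1 h
        rw [← h1, ← h2]
        exact ⟨hx, hb⟩
      · rintro ⟨h1, h2⟩
        exact ⟨_, h1, _, h2, rfl⟩
    · rw [Finset.card_biUnion]
      · simp only [ff]
        rw [← sum_rank (fun r => ff n (r + 1)) S]
        apply Finset.sum_congr rfl
        intro x _
        rw [Finset.card_image_of_injective, hc]
        intro b b' h
        exact (Fin.cons_inj.1 h).2
      · intro x _ y _ hxy
        rw [Function.onFun, Finset.disjoint_left]
        intro a ha hb
        obtain ⟨b, _, rfl⟩ := Finset.mem_image.1 ha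
        obtain ⟨b', _, h⟩ := Finset.mem_image.1 hb
        exact hxy (Fin.cons_inj.1 h).1.symm

theorem stmt4 (n k : ℕ) :
    ({v : Fin n → ℕ | (∀ i : Fin n, 1 ≤ v i ∧ v i ≤ (i : ℕ) + 1 + k) ∧ Cond v}.ncard : ℚ)
      = gc n k := by
  obtain ⟨F, hF, hc⟩ := PP_count n (Finset.Ico (-((k : ℤ) + 1)) 0) 0
    (fun s hs => (Finset.mem_Ico.1 hs).2)
  have hk : (Finset.Ico (-((k : ℤ) + 1)) 0).card = k + 1 := by
    rw [Int.card_Ico]; omega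
  rw [← ff_gc, ← hk, ← hc, ← Set.ncard_coe_finset F]
  congr 1
  have hinj : Function.Injective
      (fun (v : Fin n → ℕ) (j : Fin n) => (((j : ℕ) : ℤ) - (v j : ℤ))) := by
    intro v w h
    funext j
    have := congrFun h j
    simp only at this
    omega
  rw [← Set.ncard_image_of_injective _ hinj]
  congr 1
  ext a
  simp only [Set.mem_image, Set.mem_ofPred_eq, Finset.mem_coe, hF, PP, Cond, Finset.mem_Ico]
  constructor
  · rintro ⟨v, ⟨h1, h2⟩, rfl⟩
    refine ⟨fun j => ?_, fun i j hij => ?_⟩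
    · have := h1 j
      simp only
      omega
    · have := h2 i j hij
      simp only
      omega
  · rintro ⟨h1, h2⟩
    have h3 : ∀ j : Fin n, (((((j : ℕ) : ℤ) - a j).toNat : ℕ) : ℤ) = ((j : ℕ) : ℤ) - a j := by
      intro j
      have := h1 j
      omega
    refine ⟨fun j => (((j : ℕ) : ℤ) - a j).toNat, ⟨fun j => ?_, fun i j hij => ?_⟩, ?_⟩
    · have := h1 j
      simp only
      omega
    · have := h2 i j hij
      simp only [h3]
      omega
    · funext j
      simp only [h3]
      omega
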